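/- arXiv:math/0610851 — 2 statements merged into one kernel-verified Lean document; each statement's English description precedes it below -/
import Mathlib

section
/- For each fixed s ∈ ℂ, the one-parameter family t ↦ L^(t, s·t) of Lie algebra structures on the ℂ-vector space with basis {Vₙ}_{n∈ℤ}, whose structure constants are polynomial in t, satisfies: L^(0,0) is isomorphic to the Witt algebra W, while for every t ≠ 0 the Lie algebra L^(t, s·t) is not isomorphic to W. Hence the Witt algebra admits a geometric deformation over the affine line that is non-trivial when restricted to every neighbourhood of t = 0. -/
open scoped Classical

/-- The bracket `[Vₙ,Vₘ]` in the case `n` odd, `m` even: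
`(m−n)Vₙ₊ₘ + (m−n−1)·3e₁Vₙ₊ₘ₋₂ + (m−n−2)(e₁−e₂)(e₁−e₃)Vₙ₊ₘ₋₄`,
where `e₃ = −(e₁+e₂)`. -/
noncomputable def VbrOE (e₁ e₂ : ℂ) (n m : ℤ) : ℤ →₀ ℂ :=
  ((m - n : ℤ) : ℂ) • Finsupp.single (n + m) 1
    + (((m - n - 1 : ℤ) : ℂ) * (3 * e₁)) • Finsupp.single (n + m - 2) 1
    + (((m - n - 2 : ℤ) : ℂ) * ((e₁ - e₂) * (e₁ - (-(e₁ + e₂))))) •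
        Finsupp.single (n + m - 4) 1

/-- The bracket `[Vₙ,Vₘ]` of the family `L^(e₁,e₂)` on basis elements,
where the basis vector `Vₙ` is modeled as `Finsupp.single n 1 : ℤ →₀ ℂ`. -/
noncomputable def Vbr (e₁ e₂ : ℂ) (n m : ℤ) : ℤ →₀ ℂ :=
  if Odd n then
    if Odd m then
      ((m - n : ℤ) : ℂ) • Finsupp.single (n + m) 1
    else VbrOE e₁ e₂ n m
  else
    if Odd m then - VbrOE e₁ e₂ m n
    else
      ((m - n : ℤ) : ℂ) •
        (Finsupp.single (n + m) 1 + (3 * e₁) • Finsupp.single (n + m - 2) 1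
          + ((e₁ - e₂) * (e₁ - (-(e₁ + e₂)))) • Finsupp.single (n + m - 4) 1)

/-- The bilinear extension of the bracket of `L^(e₁,e₂)`. -/
noncomputable def Lbr (e₁ e₂ : ℂ) (f g : ℤ →₀ ℂ) : ℤ →₀ ℂ :=
  f.sum fun n a => g.sum fun m b => (a * b) • Vbr e₁ e₂ n m

/-- The Witt algebra bracket, on the ℂ-vector space with basis
`{lₙ}_{n∈ℤ}` (with `lₙ = Finsupp.single n 1`): `[lₙ,lₘ] = (m−n)lₙ₊ₘ`,
extended bilinearly. -/
noncomputable def Wbr (f g : ℤ →₀ ℂ) : ℤ →₀ ℂ :=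
  f.sum fun n a => g.sum fun m b =>
    (a * b) • (((m - n : ℤ) : ℂ) • Finsupp.single (n + m) 1)

theorem Vbr_zero (n m : ℤ) :
    Vbr 0 0 n m = ((m - n : ℤ) : ℂ) • Finsupp.single (n + m) 1 := by
  unfold Vbr VbrOE
  split_ifs
  · rfl
  · simp
  · rw [add_comm m n]
    simp [← Finsupp.single_neg]
  · simp

/-- The level-`k` leading coefficient functional. -/
noncomputable def lam (d : ℤ → ℤ) (μ : ℤ → ℂ) (k : ℤ) : (ℤ →₀ ℂ) →ₗ[ℂ] ℂ :=
  Finsupp.linearCombination ℂ (fun n => if d n = k then μ n else 0)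

theorem lam_apply (d : ℤ → ℤ) (μ : ℤ → ℂ) (k : ℤ) (x : ℤ →₀ ℂ) :
    lam d μ k x = x.sum fun n a => a * (if d n = k then μ n else 0) := by
  simp [lam, Finsupp.linearCombination_apply]

theorem lam_single (d : ℤ → ℤ) (μ : ℤ → ℂ) (k n : ℤ) (a : ℂ) :
    lam d μ k (Finsupp.single n a) = a * (if d n = k then μ n else 0) := by
  simp [lam]

theorem lam_zero (d : ℤ → ℤ) (μ : ℤ → ℂ) (k : ℤ) (x : ℤ →₀ ℂ)
    (hx : ∀ n, d n ≤ k → x n = 0) : lam d μ k x = 0 := by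
  rw [lam_apply]
  apply Finset.sum_eq_zero
  intro n _
  dsimp only
  split_ifs with h
  · rw [hx n h.le, zero_mul]
  · simp

theorem Lbr_filt (e₁ e₂ : ℂ) (d : ℤ → ℤ)
    (h1 : ∀ n m p, d p < d n + d m → Vbr e₁ e₂ n m p = 0)
    (x y : ℤ →₀ ℂ) (j k : ℤ) (hx : ∀ n, d n < j → x n = 0)
    (hy : ∀ n, d n < k → y n = 0) (p : ℤ) (hp : d p < j + k) : Lbr e₁ e₂ x y p = 0 := by
  unfold Lbr Finsupp.sum
  rw [Finsupp.finsetSum_apply]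
  apply Finset.sum_eq_zero
  intro n hn
  rw [Finsupp.finsetSum_apply]
  apply Finset.sum_eq_zero
  intro m hm
  have a1 : j ≤ d n := by
    by_contra h
    exact (Finsupp.mem_support_iff.1 hn) (hx n (by omega))
  have a2 : k ≤ d m := by
    by_contra h
    exact (Finsupp.mem_support_iff.1 hm) (hy m (by omega))
  simp [h1 n m p (by omega)]

theorem Lbr_lam (e₁ e₂ : ℂ) (d : ℤ → ℤ) (μ : ℤ → ℂ) (c : ℂ)
    (h1 : ∀ n m p, d p < d n + d m → Vbr e₁ e₂ n m p = 0)
    (h2 : ∀ n m, lam d μ (d n + d m) (Vbr e₁ e₂ n m)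
      = c * ((d m - d n : ℤ) : ℂ) * μ n * μ m)
    (x y : ℤ →₀ ℂ) (j k : ℤ) (hx : ∀ n, d n < j → x n = 0)
    (hy : ∀ n, d n < k → y n = 0) :
    lam d μ (j + k) (Lbr e₁ e₂ x y)
      = c * ((k - j : ℤ) : ℂ) * lam d μ j x * lam d μ k y := by
  rw [lam_apply d μ j x, lam_apply d μ k y]
  unfold Lbr Finsupp.sum
  rw [map_sum, mul_assoc, Finset.sum_mul_sum, Finset.mul_sum]
  apply Finset.sum_congr rfl
  intro n hn
  rw [map_sum, Finset.mul_sum]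
  apply Finset.sum_congr rfl
  intro m hm
  have a1 : j ≤ d n := by
    by_contra h
    exact (Finsupp.mem_support_iff.1 hn) (hx n (by omega))
  have a2 : k ≤ d m := by
    by_contra h
    exact (Finsupp.mem_support_iff.1 hm) (hy m (by omega))
  rw [map_smul, smul_eq_mul]
  by_cases hh : d n = j ∧ d m = k
  · obtain ⟨rfl, rfl⟩ := hh
    rw [h2]
    simp only [if_true]
    ring
  · rw [lam_zero d μ (j + k) _ (fun p hp => h1 n m p (by omega))]
    by_cases h3 : d n = j
    · have h4 : d m ≠ k := fun h => hh ⟨h3, h⟩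
      simp [h4]
    · simp [h3]

/-- A locally finite element has no leading coefficient in negative degrees. -/
theorem lf_lam (e₁ e₂ : ℂ) (d : ℤ → ℤ) (μ : ℤ → ℂ) (c : ℂ) (hc : c ≠ 0)
    (hμ : ∀ n, μ n ≠ 0) (hd : Function.Surjective d)
    (h1 : ∀ n m p, d p < d n + d m → Vbr e₁ e₂ n m p = 0)
    (h2 : ∀ n m, lam d μ (d n + d m) (Vbr e₁ e₂ n m)
      = c * ((d m - d n : ℤ) : ℂ) * μ n * μ m)
    (h : ℤ →₀ ℂ)
    (lf : ∀ y, ∃ T : Finset ℤ, ∀ i : ℕ, ((Lbr e₁ e₂ h)^[i] y).support ⊆ T)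
    (j : ℤ) (hj : j < 0) (hh : ∀ n, d n < j → h n = 0) : lam d μ j h = 0 := by
  by_contra hne
  obtain ⟨q, hq⟩ := hd (j - 1)
  obtain ⟨T, hT⟩ := lf (Finsupp.single q 1)
  have key : ∀ i : ℕ, (∀ n, d n < (j - 1) + i * j →
        ((Lbr e₁ e₂ h)^[i] (Finsupp.single q 1)) n = 0) ∧
      lam d μ ((j - 1) + i * j) ((Lbr e₁ e₂ h)^[i] (Finsupp.single q 1)) ≠ 0 := by
    intro i
    induction i with
    | zero =>
      constructor
      · intro n hn
        have : q ≠ n := by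
          rintro rfl
          simp [hq] at hn
        simp [this]
      · simp [lam_single, hq, hμ]
    | succ i ih =>
      have e : (j - 1) + ((i + 1 : ℕ) : ℤ) * j = j + ((j - 1) + i * j) := by
        push_cast; ring
      rw [Function.iterate_succ_apply', e]
      refine ⟨fun n hn => Lbr_filt e₁ e₂ d h1 _ _ _ _ hh ih.1 n hn, ?_⟩
      rw [Lbr_lam e₁ e₂ d μ c h1 h2 _ _ _ _ hh ih.1]
      refine mul_ne_zero (mul_ne_zero (mul_ne_zero hc ?_) hne) ih.2
      rw [Int.cast_ne_zero]
      have : (i : ℤ) * j ≤ 0 := mul_nonpos_of_nonneg_of_nonpos (by positivity) hj.le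
      omega
  obtain ⟨M, hM⟩ : ∃ M : ℤ, ∀ n ∈ T, M ≤ d n := by
    obtain ⟨M, hM⟩ := (T.image d).bddBelow
    exact ⟨M, fun n hn => hM (by simpa using ⟨n, hn, rfl⟩)⟩
  have k2 := (key M.natAbs).2
  apply k2
  apply lam_zero
  intro n hn
  by_contra hn0
  have := hM n (hT M.natAbs (Finsupp.mem_support_iff.2 hn0))
  have h3 : (M.natAbs : ℤ) * j ≤ (M.natAbs : ℤ) * (-1) :=
    mul_le_mul_of_nonneg_left (by omega) (by positivity)
  omega

theorem lam_min_inj (d : ℤ → ℤ) (hd : Function.Injective d) (μ : ℤ → ℂ) (n : ℤ)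
    (x : ℤ →₀ ℂ) : lam d μ (d n) x = x n * μ n := by
  rw [lam_apply, Finsupp.sum, Finset.sum_eq_single n]
  · simp
  · intro m _ hm
    have : d m ≠ d n := fun h => hm (hd h)
    simp [this]
  · intro hn
    simp [Finsupp.notMem_support_iff.1 hn]

theorem exists_min (d : ℤ → ℤ) (h : ℤ →₀ ℂ) (n : ℤ) (hn : h n ≠ 0) :
    ∃ n₀, h n₀ ≠ 0 ∧ d n₀ ≤ d n ∧ ∀ m, d m < d n₀ → h m = 0 := by
  obtain ⟨n₀, h0, h1⟩ := h.support.exists_min_image d ⟨n, Finsupp.mem_support_iff.2 hn⟩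
  refine ⟨n₀, Finsupp.mem_support_iff.1 h0, h1 n (Finsupp.mem_support_iff.2 hn), ?_⟩
  intro m hm
  by_contra hm0
  have := h1 m (Finsupp.mem_support_iff.2 hm0)
  omega

theorem lf_inj (e₁ e₂ : ℂ) (d : ℤ → ℤ) (μ : ℤ → ℂ) (c : ℂ) (hc : c ≠ 0)
    (hμ : ∀ n, μ n ≠ 0) (hd : Function.Bijective d)
    (h1 : ∀ n m p, d p < d n + d m → Vbr e₁ e₂ n m p = 0)
    (h2 : ∀ n m, lam d μ (d n + d m) (Vbr e₁ e₂ n m)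
      = c * ((d m - d n : ℤ) : ℂ) * μ n * μ m)
    (h : ℤ →₀ ℂ)
    (lf : ∀ y, ∃ T : Finset ℤ, ∀ i : ℕ, ((Lbr e₁ e₂ h)^[i] y).support ⊆ T)
    (n : ℤ) (hn : d n < 0) : h n = 0 := by
  by_contra hne
  obtain ⟨n₀, h0, hle, hmin⟩ := exists_min d h n hne
  have := lf_lam e₁ e₂ d μ c hc hμ hd.2 h1 h2 h lf (d n₀) (by omega) hmin
  rw [lam_min_inj d hd.1] at this
  exact mul_ne_zero h0 (hμ n₀) this

theorem top_zero (e₁ e₂ : ℂ) (h : ℤ →₀ ℂ)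
    (lf : ∀ y, ∃ T : Finset ℤ, ∀ i : ℕ, ((Lbr e₁ e₂ h)^[i] y).support ⊆ T)
    (n : ℤ) (hn : 0 < n) : h n = 0 := by
  refine lf_inj e₁ e₂ (fun n => -n) (fun _ => 1) (-1) (by simp) (by simp)
    ⟨neg_injective, neg_surjective⟩ ?_ ?_ h lf n (by simpa using hn)
  · intro n m p hp
    have p1 : n + m ≠ p := by omega
    have p1' : m + n ≠ p := by omega
    have p2 : n + m - 2 ≠ p := by omega
    have p2' : m + n - 2 ≠ p := by omega
    have p3 : n + m - 4 ≠ p := by omega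
    have p3' : m + n - 4 ≠ p := by omega
    unfold Vbr VbrOE
    split_ifs <;> simp [p1, p2, p3, p1', p2', p3']
  · intro n m
    rw [show (-n + -m) = (fun n : ℤ => -n) (n + m) by simp; ring,
      lam_min_inj _ neg_injective]
    unfold Vbr VbrOE
    rw [add_comm m n]
    split_ifs <;> simp [Finsupp.single_apply] <;> ring

theorem bot1_zero (e₁ e₂ r : ℂ) (hr : r ≠ 0)
    (hb : (e₁ - e₂) * (e₁ - (-(e₁ + e₂))) = r * r) (h : ℤ →₀ ℂ)
    (lf : ∀ y, ∃ T : Finset ℤ, ∀ i : ℕ, ((Lbr e₁ e₂ h)^[i] y).support ⊆ T)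
    (n : ℤ) (hn : n ≤ 0) : h n = 0 := by
  refine lf_inj e₁ e₂ (fun n => if Odd n then n - 2 else n - 4)
    (fun n => if Odd n then r else r * r) 1 (by simp) ?_
    ⟨?_, ?_⟩ ?_ ?_ h lf n ?_
  · intro n
    try dsimp only
    split_ifs <;> simp [hr]
  · intro n m hnm
    try dsimp only at hnm
    split_ifs at hnm <;> grind
  · intro n
    by_cases hn : Odd n
    · exact ⟨n + 2, by dsimp only; rw [if_pos (by grind)]; ring⟩
    · exact ⟨n + 4, by dsimp only; rw [if_neg (by grind)]; ring⟩
  · intro n m p hp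
    unfold Vbr VbrOE
    rw [hb]
    try dsimp only at hp
    by_cases on : Odd n <;> by_cases om : Odd m <;> simp only [on, om, if_true, if_false] at hp ⊢
    all_goals
      simp only [Finsupp.single_apply, Finsupp.smul_apply, Finsupp.add_apply, Finsupp.neg_apply]
      repeat rw [if_neg (by grind)]
      simp
  · intro n m
    unfold Vbr VbrOE
    rw [hb]
    try dsimp only
    by_cases on : Odd n <;> by_cases om : Odd m <;> simp only [on, om, if_true, if_false]
    all_goals
      simp only [map_add, map_smul, map_neg, lam_single, smul_eq_mul]
    · have o1 : ¬ Odd (n + m) := by grind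
      rw [if_neg o1, if_neg o1, if_pos (by ring)]
      push_cast; ring
    · have o1 : Odd (n + m) := by grind
      have o2 : Odd (n + m - 2) := by grind
      have o3 : Odd (n + m - 4) := by grind
      simp only [o1, o2, o3, if_true]
      rw [if_neg (by omega), if_neg (by omega), if_pos (by omega)]
      push_cast; ring
    · have o1 : Odd (m + n) := by grind
      have o2 : Odd (m + n - 2) := by grind
      have o3 : Odd (m + n - 4) := by grind
      simp only [o1, o2, o3, if_true]
      rw [if_neg (by omega), if_neg (by omega), if_pos (by omega)]
      push_cast; ring
    · have o1 : ¬ Odd (n + m) := by grind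
      have o2 : ¬ Odd (n + m - 2) := by grind
      have o3 : ¬ Odd (n + m - 4) := by grind
      simp only [o1, o2, o3, if_false]
      rw [if_neg (by omega), if_neg (by omega), if_pos (by omega)]
      push_cast; ring
  · try dsimp only
    split_ifs <;> omega

theorem bot2_lam (e₁ e₂ r : ℂ) (hr : r ≠ 0) (ha : 3 * e₁ = r * r)
    (hb : (e₁ - e₂) * (e₁ - (-(e₁ + e₂))) = 0) (h : ℤ →₀ ℂ)
    (lf : ∀ y, ∃ T : Finset ℤ, ∀ i : ℕ, ((Lbr e₁ e₂ h)^[i] y).support ⊆ T)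
    (j : ℤ) (hj : j < 0) (hh : ∀ n : ℤ, (n - 1) / 2 < j → h n = 0) :
    lam (fun n => (n - 1) / 2) (fun n => if Odd n then 1 else r) j h = 0 := by
  refine lf_lam e₁ e₂ (fun n => (n - 1) / 2) (fun n => if Odd n then 1 else r) (2 * r)
    (by simp [hr]) ?_ ?_ ?_ ?_ h lf j hj hh
  · intro n
    try dsimp only
    split_ifs <;> simp [hr]
  · intro n
    exact ⟨2 * n + 1, by dsimp only; omega⟩
  · intro n m p hp
    unfold Vbr VbrOE
    rw [hb]
    try dsimp only at hp
    by_cases on : Odd n <;> by_cases om : Odd m <;> simp only [on, om, if_true, if_false] at hp ⊢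
    all_goals
      simp only [Finsupp.single_apply, Finsupp.smul_apply, Finsupp.add_apply, Finsupp.neg_apply,
        mul_zero, zero_smul, neg_zero, add_zero, Finsupp.zero_apply]
      rw [Int.odd_iff] at on om
      repeat rw [if_neg (by omega)]
      simp
  · intro n m
    unfold Vbr VbrOE
    rw [hb, ha]
    try dsimp only
    by_cases on : Odd n <;> by_cases om : Odd m <;> simp only [on, om, if_true, if_false]
    all_goals
      simp only [map_add, map_smul, map_neg, lam_single, smul_eq_mul]
    · have o1 : ¬ Odd (n + m) := by grind
      obtain ⟨a, rfl⟩ := on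
      obtain ⟨b, rfl⟩ := om
      rw [if_neg o1, if_pos (by omega), show (2 * b + 1 - 1) / 2 = b by omega,
        show (2 * a + 1 - 1) / 2 = a by omega]
      push_cast; ring
    · have o2 : Odd (n + m - 2) := by grind
      obtain ⟨a, rfl⟩ := on
      obtain ⟨b, rfl⟩ := Int.not_odd_iff_even.1 om
      rw [if_pos o2, if_neg (by omega), if_pos (by omega), show (b + b - 1) / 2 = b - 1 by omega,
        show (2 * a + 1 - 1) / 2 = a by omega]
      push_cast; ring
    · have o2 : Odd (m + n - 2) := by grind
      obtain ⟨a, rfl⟩ := om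
      obtain ⟨b, rfl⟩ := Int.not_odd_iff_even.1 on
      rw [if_pos o2, if_neg (by omega), if_pos (by omega), show (b + b - 1) / 2 = b - 1 by omega,
        show (2 * a + 1 - 1) / 2 = a by omega]
      push_cast; ring
    · have o2 : ¬ Odd (n + m - 2) := by grind
      obtain ⟨a, rfl⟩ := Int.not_odd_iff_even.1 on
      obtain ⟨b, rfl⟩ := Int.not_odd_iff_even.1 om
      rw [if_neg o2, if_neg (by omega), if_pos (by omega), show (b + b - 1) / 2 = b - 1 by omega,
        show (a + a - 1) / 2 = a - 1 by omega]
      push_cast; ring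

theorem lam_two (r : ℂ) (j : ℤ) (h : ℤ →₀ ℂ) :
    lam (fun n => (n - 1) / 2) (fun n => if Odd n then 1 else r) j h
      = h (2 * j + 1) + r * h (2 * j + 2) := by
  induction h using Finsupp.induction_linear with
  | zero => simp
  | add f g hf hg => rw [map_add, hf, hg]; simp only [Finsupp.add_apply]; ring
  | single n a =>
    rw [lam_single]
    simp only [Finsupp.single_apply]
    by_cases on : Odd n
    · obtain ⟨k, rfl⟩ := on
      by_cases hk : k = j
      · subst hk
        rw [if_pos (by omega), if_pos (by grind), if_pos rfl, if_neg (by omega)]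
        ring
      · rw [if_neg (by omega), if_neg (by omega), if_neg (by omega)]
        ring
    · obtain ⟨k, rfl⟩ := Int.not_odd_iff_even.1 on
      by_cases hk : k = j + 1
      · subst hk
        rw [if_pos (by omega), if_neg on, if_neg (by omega), if_pos (by omega)]
        ring
      · rw [if_neg (by omega), if_neg (by omega), if_neg (by omega)]
        ring

theorem bot2_zero (e₁ e₂ r : ℂ) (hr : r ≠ 0) (ha : 3 * e₁ = r * r)
    (hb : (e₁ - e₂) * (e₁ - (-(e₁ + e₂))) = 0) (h : ℤ →₀ ℂ)
    (lf : ∀ y, ∃ T : Finset ℤ, ∀ i : ℕ, ((Lbr e₁ e₂ h)^[i] y).support ⊆ T)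
    (n : ℤ) (hn : n ≤ 0) : h n = 0 := by
  by_contra hne
  obtain ⟨n₀, h0, hle, hmin⟩ := exists_min (fun n => (n - 1) / 2) h n hne
  try dsimp only at hle hmin
  have q1 := bot2_lam e₁ e₂ r hr ha hb h lf ((n₀ - 1) / 2) (by omega) hmin
  have q2 := bot2_lam e₁ e₂ (-r) (by simpa using hr) (by rw [ha]; ring) hb h lf
    ((n₀ - 1) / 2) (by omega) hmin
  rw [lam_two] at q1 q2
  have z1 : h (2 * ((n₀ - 1) / 2) + 1) = 0 := by linear_combination (q1 + q2) / 2
  have z2 : h (2 * ((n₀ - 1) / 2) + 2) = 0 := by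
    have : r * h (2 * ((n₀ - 1) / 2) + 2) = 0 := by linear_combination (q1 - q2) / 2
    exact (mul_eq_zero.1 this).resolve_left hr
  rcases Int.even_or_odd' n₀ with ⟨k, hk | hk⟩
  · exact h0 (by rw [show n₀ = 2 * ((n₀ - 1) / 2) + 2 by omega]; exact z2)
  · exact h0 (by rw [show n₀ = 2 * ((n₀ - 1) / 2) + 1 by omega]; exact z1)

theorem Wbr_zero_apply (g : ℤ →₀ ℂ) (n : ℤ) :
    Wbr (Finsupp.single 0 1) g n = n * g n := by
  unfold Wbr
  rw [Finsupp.sum_single_index (by simp)]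
  simp only [Finsupp.sum, Finsupp.finsetSum_apply]
  rw [Finset.sum_eq_single n]
  · simp; ring
  · intro m _ hm
    simp [hm]
  · intro hn
    simp [Finsupp.notMem_support_iff.1 hn]

theorem lf_of_iso (e₁ e₂ : ℂ) (φ : (ℤ →₀ ℂ) ≃ₗ[ℂ] (ℤ →₀ ℂ))
    (hφ : ∀ f g : ℤ →₀ ℂ, φ (Lbr e₁ e₂ f g) = Wbr (φ f) (φ g)) (y : ℤ →₀ ℂ) :
    ∃ T : Finset ℤ, ∀ i : ℕ,
      ((Lbr e₁ e₂ (φ.symm (Finsupp.single 0 1)))^[i] y).support ⊆ T := by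
  refine ⟨(φ y).support.biUnion fun n => (φ.symm (Finsupp.single n 1)).support, fun i => ?_⟩
  have hs : (φ ((Lbr e₁ e₂ (φ.symm (Finsupp.single 0 1)))^[i] y)).support ⊆ (φ y).support := by
    induction i with
    | zero => simp
    | succ i ih =>
      rw [Function.iterate_succ_apply', hφ, LinearEquiv.apply_symm_apply]
      refine subset_trans ?_ ih
      intro n hn
      rw [Finsupp.mem_support_iff, Wbr_zero_apply] at hn
      exact Finsupp.mem_support_iff.2 (right_ne_zero_of_mul hn)
  generalize (Lbr e₁ e₂ (φ.symm (Finsupp.single 0 1)))^[i] y = z at hs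
  have hz : z = ∑ n ∈ (φ z).support, (φ z n) • φ.symm (Finsupp.single n 1) := by
    apply φ.injective
    rw [map_sum]
    simp only [map_smul, LinearEquiv.apply_symm_apply, Finsupp.smul_single, smul_eq_mul, mul_one]
    exact (Finsupp.sum_single (φ z)).symm
  intro p hp
  rw [Finsupp.mem_support_iff] at hp
  by_contra hne
  apply hp
  rw [hz, Finsupp.finsetSum_apply]
  apply Finset.sum_eq_zero
  intro n hn
  have : φ.symm (Finsupp.single n 1) p = 0 := by
    by_contra h0
    exact hne (Finset.mem_biUnion.2 ⟨n, hs hn, Finsupp.mem_support_iff.2 h0⟩)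
  simp [this]

/-- For each fixed `s ∈ ℂ`, the one-parameter family
`t ↦ L^(t, s·t)` of Lie algebra structures satisfies: `L^(0,0)` is
isomorphic to the Witt algebra `W`, while for every `t ≠ 0` the Lie algebra
`L^(t, s·t)` is not isomorphic to `W`. Hence the Witt algebra admits a
geometric deformation over the affine line that is non-trivial when
restricted to every neighbourhood of `t = 0`. -/
theorem Witt_nontrivial_geometric_deformation (s : ℂ) :
    (∃ φ : (ℤ →₀ ℂ) ≃ₗ[ℂ] (ℤ →₀ ℂ),
      ∀ f g : ℤ →₀ ℂ, φ (Lbr 0 0 f g) = Wbr (φ f) (φ g)) ∧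
    (∀ t : ℂ, t ≠ 0 →
      ¬ ∃ φ : (ℤ →₀ ℂ) ≃ₗ[ℂ] (ℤ →₀ ℂ),
          ∀ f g : ℤ →₀ ℂ, φ (Lbr t (s * t) f g) = Wbr (φ f) (φ g)) := by
  constructor
  · refine ⟨LinearEquiv.refl ℂ _, fun f g => ?_⟩
    simp only [LinearEquiv.refl_apply, Lbr, Wbr, Vbr_zero]
  · rintro t ht ⟨φ, hφ⟩
    have lf := lf_of_iso t (s * t) φ hφ
    have h0 : φ.symm (Finsupp.single 0 1) = 0 := by
      ext n
      rw [Finsupp.zero_apply]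
      rcases lt_or_ge 0 n with hn | hn
      · exact top_zero t (s * t) _ lf n hn
      · by_cases hb : (t - s * t) * (t - (-(t + s * t))) = 0
        · obtain ⟨r, hr⟩ := IsAlgClosed.exists_eq_mul_self (3 * t)
          refine bot2_zero t (s * t) r ?_ hr hb _ lf n hn
          rintro rfl
          simp [ht] at hr
        · obtain ⟨r, hr⟩ := IsAlgClosed.exists_eq_mul_self ((t - s * t) * (t - (-(t + s * t))))
          refine bot1_zero t (s * t) r ?_ hr _ lf n hn
          rintro rfl
          exact hb (by rw [hr, mul_zero])
    have h1 : (Finsupp.single 0 1 : ℤ →₀ ℂ) = 0 := by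
      simpa using h0
    simp at h1
end

section
/- Let 𝔤 be a finite-dimensional simple complex Lie algebra and s ∈ ℂ. For every e₁ ∈ ℂ with e₁ ≠ 0, the Lie algebra Ḡ^(e₁, s·e₁) is not isomorphic (as a complex Lie algebra) to the classical current algebra 𝔤 ⊗ ℂ[z,z⁻¹]; hence the family over the line D_s is locally non-trivial despite the formal rigidity of 𝔤 ⊗ ℂ[z,z⁻¹]. -/
open scoped TensorProduct

open scoped Classical

/-- The bracket of the genus-one current algebra family
`Ḡ^(e₁,e₂) = 𝔤 ⊗ A^(e₁,e₂)`, where the tensor product of `𝔤` with the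
ℂ-vector space with basis `{Aₙ}_{n∈ℤ}` is modeled as `ℤ →₀ 𝔤`, the pure
tensor `x ⊗ Aₙ` corresponding to `Finsupp.single n x`.  The bracket is the
bilinear extension of:
`[x ⊗ Aₙ, y ⊗ Aₘ] = [x,y] ⊗ Aₙ₊ₘ` if `n` or `m` is even, and
`[x ⊗ Aₙ, y ⊗ Aₘ] = [x,y] ⊗ (Aₙ₊ₘ + 3e₁Aₙ₊ₘ₋₂ + (e₁−e₂)(2e₁+e₂)Aₙ₊ₘ₋₄)`
if both `n` and `m` are odd. -/
noncomputable def Gbr (𝔤 : Type*) [LieRing 𝔤] [LieAlgebra ℂ 𝔤]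
    (e₁ e₂ : ℂ) (f g : ℤ →₀ 𝔤) : ℤ →₀ 𝔤 :=
  f.sum fun n x => g.sum fun m y =>
    if Odd n ∧ Odd m then
      Finsupp.single (n + m) ⁅x, y⁆ + (3 * e₁) • Finsupp.single (n + m - 2) ⁅x, y⁆
        + ((e₁ - e₂) * (2 * e₁ + e₂)) • Finsupp.single (n + m - 4) ⁅x, y⁆
    else Finsupp.single (n + m) ⁅x, y⁆

lemma schur_simple {𝔤 : Type} [LieRing 𝔤] [LieAlgebra ℂ 𝔤]
    [FiniteDimensional ℂ 𝔤] [LieAlgebra.IsSimple ℂ 𝔤] (l : 𝔤 →ₗ[ℂ] 𝔤)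
    (h : ∀ x y : 𝔤, l ⁅x, y⁆ = ⁅x, l y⁆) : ∃ c : ℂ, ∀ x, l x = c • x := by
  have : Nontrivial 𝔤 := LieAlgebra.IsSimple.nontrivial ℂ 𝔤
  obtain ⟨c, hc⟩ := Module.End.exists_eigenvalue l
  refine ⟨c, ?_⟩
  let I : LieIdeal ℂ 𝔤 :=
    { Module.End.eigenspace l c with
      lie_mem := by
        intro x m hm
        have hm' : m ∈ Module.End.eigenspace l c := hm
        rw [Module.End.mem_eigenspace_iff] at hm'
        change ⁅x, m⁆ ∈ Module.End.eigenspace l c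
        rw [Module.End.mem_eigenspace_iff, h, hm', lie_smul] }
  have hI : ∀ x, x ∈ I ↔ l x = c • x := fun x => Module.End.mem_eigenspace_iff
  rcases LieAlgebra.IsSimple.eq_bot_or_eq_top (R := ℂ) I with h0 | h1
  · exfalso
    obtain ⟨v, hv, hv0⟩ := hc.exists_hasEigenvector
    have : v ∈ I := hv
    rw [h0] at this
    exact hv0 (by simpa using this)
  · intro x
    rw [← hI, h1]; trivial

lemma span_brackets (𝔤 : Type) [LieRing 𝔤] [LieAlgebra ℂ 𝔤] [LieAlgebra.IsSimple ℂ 𝔤] :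
    Submodule.span ℂ {m : 𝔤 | ∃ x y : 𝔤, ⁅x, y⁆ = m} = ⊤ := by
  let I : LieIdeal ℂ 𝔤 :=
    { Submodule.span ℂ {m : 𝔤 | ∃ x y : 𝔤, ⁅x, y⁆ = m} with
      lie_mem := by
        intro x m _
        exact Submodule.subset_span ⟨x, m, rfl⟩ }
  rcases LieAlgebra.IsSimple.eq_bot_or_eq_top (R := ℂ) I with h0 | h1
  · exfalso
    apply LieAlgebra.IsSimple.non_abelian ℂ (L := 𝔤)
    refine ⟨fun x y => ?_⟩
    have : ⁅x, y⁆ ∈ I := Submodule.subset_span ⟨x, y, rfl⟩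
    rw [h0] at this
    simpa using this
  · rw [eq_top_iff]
    intro x _
    have : x ∈ I := by rw [h1]; trivial
    exact this

lemma centroid_mul {𝔤 : Type} [LieRing 𝔤] [LieAlgebra ℂ 𝔤]
    [FiniteDimensional ℂ 𝔤] [LieAlgebra.IsSimple ℂ 𝔤]
    {B : Type} [CommRing B] [Algebra ℂ B] (S : (B ⊗[ℂ] 𝔤) →ₗ[ℂ] (B ⊗[ℂ] 𝔤))
    (h : ∀ x y : B ⊗[ℂ] 𝔤, S ⁅x, y⁆ = ⁅x, S y⁆) : ∃ c : B, ∀ w, S w = c • w := by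
  have : Nontrivial 𝔤 := LieAlgebra.IsSimple.nontrivial ℂ 𝔤
  let b := Module.Basis.ofVectorSpace ℂ B
  let E := TensorProduct.equivFinsuppOfBasisLeft (N := 𝔤) b
  have hE : ∀ (x : 𝔤) (w : B ⊗[ℂ] 𝔤) i, E ⁅(1 : B) ⊗ₜ[ℂ] x, w⁆ i = ⁅x, E w i⁆ := by
    intro x w i
    induction w using TensorProduct.induction_on with
    | zero => simp
    | tmul p y =>
      rw [LieAlgebra.ExtendScalars.bracket_tmul]
      simp [E]
    | add u v hu hv => simp [hu, hv]
  have key : ∀ i, ∃ c : ℂ, ∀ x, E (S (1 ⊗ₜ x)) i = c • x := by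
    intro i
    apply schur_simple
      ((Finsupp.lapply i) ∘ₗ E.toLinearMap ∘ₗ S ∘ₗ (TensorProduct.mk ℂ B 𝔤 1))
    intro x y
    simp only [LinearMap.comp_apply, TensorProduct.mk_apply, Finsupp.lapply_apply,
      LinearEquiv.coe_coe]
    rw [← hE, ← h, LieAlgebra.ExtendScalars.bracket_tmul, one_mul]
  choose lam hlam using key
  obtain ⟨x0, hx0⟩ := exists_ne (0 : 𝔤)
  let c : B := ∑ i ∈ (E (S (1 ⊗ₜ x0))).support, lam i • b i
  have h1 : ∀ x : 𝔤, S (1 ⊗ₜ x) = c ⊗ₜ x := by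
    intro x
    apply E.injective
    ext i
    rw [hlam, TensorProduct.equivFinsuppOfBasisLeft_apply_tmul_apply]
    congr 1
    simp only [c, map_sum, map_smul, Module.Basis.repr_self, Finsupp.coe_finsetSum,
      Finset.sum_apply, Finsupp.smul_apply, Finsupp.single_apply, smul_eq_mul, mul_ite, mul_one,
      mul_zero, Finset.sum_ite_eq', Finsupp.mem_support_iff, hlam]
    split_ifs with hh
    · rfl
    · push Not at hh
      exact (smul_eq_zero.mp hh).resolve_right hx0
  refine ⟨c, fun w => ?_⟩
  induction w using TensorProduct.induction_on with
  | zero => simp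
  | add u v hu hv => simp [hu, hv]
  | tmul p y =>
    have hy : y ∈ Submodule.span ℂ {m : 𝔤 | ∃ x y : 𝔤, ⁅x, y⁆ = m} := by
      rw [span_brackets]; trivial
    induction hy using Submodule.span_induction with
    | mem m hm =>
      obtain ⟨x, y, rfl⟩ := hm
      have := h (p ⊗ₜ x) (1 ⊗ₜ y)
      rw [LieAlgebra.ExtendScalars.bracket_tmul, h1, LieAlgebra.ExtendScalars.bracket_tmul,
        mul_one] at this
      rw [this, TensorProduct.smul_tmul', smul_eq_mul, mul_comm]
    | zero => simp
    | add u v _ _ hu hv => simp [TensorProduct.tmul_add, hu, hv]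
    | smul a u _ hu => simp only [TensorProduct.tmul_smul, map_smul, hu]; rw [smul_comm]

lemma smul_faithful {𝔤 : Type} [LieRing 𝔤] [LieAlgebra ℂ 𝔤] [Nontrivial 𝔤]
    {B : Type} [CommRing B] [Algebra ℂ B] (p q : B)
    (h : ∀ w : B ⊗[ℂ] 𝔤, p • w = q • w) : p = q := by
  obtain ⟨x0, hx0⟩ := exists_ne (0 : 𝔤)
  let b := Module.Basis.ofVectorSpace ℂ B
  have h1 := h (1 ⊗ₜ x0)
  simp only [TensorProduct.smul_tmul', smul_eq_mul, mul_one] at h1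
  apply b.repr.injective
  ext i
  have := congrArg (fun w => TensorProduct.equivFinsuppOfBasisLeft (N := 𝔤) b w i) h1
  simp only [TensorProduct.equivFinsuppOfBasisLeft_apply_tmul_apply] at this
  exact smul_left_injective ℂ hx0 this

open LaurentPolynomial in
lemma laurent_unit (p q : LaurentPolynomial ℂ) (h : p * q = 1) :
    ∃ (α : ℂ) (k : ℤ), α ≠ 0 ∧ p = C α * T k := by
  obtain ⟨n, f, hf⟩ := exists_T_pow p
  obtain ⟨m, g, hg⟩ := exists_T_pow q
  have hfg : f * g = Polynomial.X ^ (n + m) := by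
    apply Polynomial.toLaurent_injective
    rw [map_mul, hf, hg, Polynomial.toLaurent_X_pow]
    push_cast
    rw [T_add]
    linear_combination (T (n : ℤ) * T (m : ℤ)) * h
  have hd : f ∣ Polynomial.X ^ (n + m) := ⟨g, hfg.symm⟩
  obtain ⟨i, _, hi⟩ := (dvd_prime_pow Polynomial.prime_X _).mp hd
  obtain ⟨u, hu⟩ := hi.symm
  obtain ⟨α, hα, hαu⟩ := Polynomial.isUnit_iff.mp u.isUnit
  refine ⟨α, (i : ℤ) - n, hα.ne_zero, ?_⟩
  have : p * T (n : ℤ) = C α * T (i : ℤ) := by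
    rw [← hf, ← hu, ← hαu, map_mul, Polynomial.toLaurent_X_pow, Polynomial.toLaurent_C, mul_comm]
  calc p = p * T (n : ℤ) * T (-(n : ℤ)) := by rw [mul_T_assoc]; simp
    _ = _ := by rw [this, mul_T_assoc, sub_eq_add_neg]

open LaurentPolynomial in
lemma laurent_parity (w v : LaurentPolynomial ℂ) (α : ℂ) (hα : α ≠ 0) (k : ℤ) (hk : Odd k)
    (hv : v ≠ 0) (h : w ^ 2 * (C α * T k) = v ^ 2) : False := by
  obtain ⟨n, f, hf⟩ := exists_T_pow w
  obtain ⟨m, g, hg⟩ := exists_T_pow v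
  obtain ⟨j, rfl⟩ := hk
  -- f^2 α T^(2j+1) T^{2m} = g^2 T^{2n}
  obtain ⟨r, s, hrs⟩ : ∃ r s : ℕ, (r : ℤ) - s = j := ⟨j.toNat, (-j).toNat, by omega⟩
  have key : f ^ 2 * (Polynomial.C α * Polynomial.X ^ (2 * r + 1 + 2 * m))
      = g ^ 2 * Polynomial.X ^ (2 * n + 2 * s) := by
    apply Polynomial.toLaurent_injective
    simp only [map_mul, map_pow, hf, hg, Polynomial.toLaurent_C, Polynomial.toLaurent_X, T_pow,
      mul_pow]
    rw [← h]
    have e1 : (T (2 * (n : ℤ)) * T ((2 * r + 1 + 2 * m : ℕ) * 1 : ℤ) : LaurentPolynomial ℂ)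
      = T (2 * j + 1) * T (2 * (m : ℤ)) * T ((2 * n + 2 * s : ℕ) * 1 : ℤ) := by
      simp only [← T_add]
      congr 1
      push_cast
      omega
    push_cast at e1 ⊢
    linear_combination w ^ 2 * C α * e1
  have hg0 : g ≠ 0 := by
    rintro rfl
    rw [map_zero] at hg
    have : v * T (m : ℤ) * T (-(m : ℤ)) = 0 := by rw [← hg, zero_mul]
    rw [mul_T_assoc] at this
    exact hv (by simpa using this)
  have hf0 : f ≠ 0 := by
    rintro rfl
    have : g ^ 2 * Polynomial.X ^ (2 * n + 2 * s) = 0 := by rw [← key]; simp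
    have hX : (Polynomial.X : Polynomial ℂ) ≠ 0 := Polynomial.X_ne_zero
    exact (mul_ne_zero (pow_ne_zero _ hg0) (pow_ne_zero _ hX)) this
  have hd := congrArg Polynomial.natDegree key
  have hX : (Polynomial.X : Polynomial ℂ) ≠ 0 := Polynomial.X_ne_zero
  have hC : (Polynomial.C α : Polynomial ℂ) ≠ 0 := by simpa using hα
  rw [Polynomial.natDegree_mul (pow_ne_zero _ hf0) (mul_ne_zero hC (pow_ne_zero _ hX)),
    Polynomial.natDegree_mul hC (pow_ne_zero _ hX),
    Polynomial.natDegree_mul (pow_ne_zero _ hg0) (pow_ne_zero _ hX)] at hd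
  simp only [Polynomial.natDegree_pow, Polynomial.natDegree_C, Polynomial.natDegree_X] at hd
  omega

/-- evaluation of Laurent polynomials at a nonzero complex number -/
noncomputable def lev (z : ℂˣ) : LaurentPolynomial ℂ →+* ℂ :=
  LaurentPolynomial.eval₂ (RingHom.id ℂ) z

open LaurentPolynomial in
lemma lev_C (z : ℂˣ) (a : ℂ) : lev z (C a) = a := by simp [lev]

open LaurentPolynomial in
lemma lev_T (z : ℂˣ) (k : ℤ) : lev z (T k) = (z : ℂ) ^ k := by simp [lev]

open LaurentPolynomial in
lemma lev_diff (p : LaurentPolynomial ℂ) : ∃ F : ℂ → ℂ,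
    (∀ z : ℂˣ, lev z p = F z) ∧ ∀ z : ℂ, z ≠ 0 → DifferentiableAt ℂ F z := by
  induction p using LaurentPolynomial.induction_on' with
  | add p q hp hq =>
    obtain ⟨F, hF, hF'⟩ := hp
    obtain ⟨G, hG, hG'⟩ := hq
    exact ⟨F + G, fun z => by simp [hF, hG], fun z hz => (hF' z hz).add (hG' z hz)⟩
  | C_mul_T n a =>
    refine ⟨fun z => a * z ^ n, fun z => by rw [map_mul, lev_C, lev_T], fun z hz => ?_⟩
    exact (differentiableAt_zpow.mpr (Or.inl hz)).const_mul a

lemma exists_zpow (y : ℂ) (hy : y ≠ 0) (k : ℤ) (hk : k ≠ 0) : ∃ z : ℂˣ, (z : ℂ) ^ k = y := by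
  have aux : ∀ (n : ℕ), n ≠ 0 → ∀ y : ℂ, y ≠ 0 → ∃ z : ℂˣ, (z : ℂ) ^ (n : ℤ) = y := by
    intro n hn y hy
    obtain ⟨z, hz⟩ := IsAlgClosed.exists_pow_nat_eq y (Nat.pos_of_ne_zero hn)
    have hz0 : z ≠ 0 := by
      rintro rfl
      rw [zero_pow hn] at hz
      exact hy hz.symm
    exact ⟨Units.mk0 z hz0, by simpa using hz⟩
  obtain ⟨n, rfl | rfl⟩ := Int.eq_nat_or_neg k
  · exact aux n (by omega) y hy
  · obtain ⟨z, hz⟩ := aux n (by omega) y⁻¹ (inv_ne_zero hy)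
    exact ⟨z, by rw [zpow_neg, hz, inv_inv]⟩

open LaurentPolynomial in
/-- The algebraic core: two points at which `t`, `u` agree. -/
lemma two_points (t u : LaurentPolynomial ℂ) (α : ℂ) (hα : α ≠ 0) (k : ℤ) (hk : k ≠ 0)
    (ht : t = C α * T k) (a b : ℂ) (hab : a + b ≠ 0)
    (h : u ^ 2 * t = (t + C a) * (t + C b)) :
    ∃ z z' : ℂˣ, z ≠ z' ∧ lev z t = lev z' t ∧ lev z t ≠ 0 ∧ lev z u = lev z' u := by
  wlog ha : a ≠ 0 generalizing a b
  · push Not at ha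
    subst ha
    exact this b 0 (by simpa using hab) (by rw [h]; ring) (by simpa using hab)
  have hu0 : ∀ z : ℂˣ, α * (z : ℂ) ^ k = -a → lev z u = 0 := by
    intro z hz
    have := congrArg (lev z) h
    simp only [ht, map_mul, map_pow, map_add, lev_C, lev_T, hz] at this
    simpa [ha] using this
  obtain ⟨z, hz⟩ := exists_zpow (-a / α) (div_ne_zero (neg_ne_zero.mpr ha) hα) k hk
  have hz' : α * (z : ℂ) ^ k = -a := by rw [hz]; field_simp
  by_cases hab' : a = b
  · subst hab'
    have hke : Even k := by
      by_contra hko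
      rw [Int.not_even_iff_odd] at hko
      refine laurent_parity u (t + C a) α hα k hko ?_ (by rw [← ht, h]; ring)
      intro h0
      obtain ⟨y, hy⟩ := exists_zpow (a / α) (div_ne_zero ha hα) k hk
      have := congrArg (lev y) h0
      simp only [ht, map_mul, map_add, lev_C, lev_T, hy, map_zero] at this
      field_simp at this
      apply hab
      linear_combination this
    have hm : α * ((-z : ℂˣ) : ℂ) ^ k = -a := by
      rw [Units.val_neg, hke.neg_zpow, hz']
    refine ⟨z, -z, ?_, ?_, ?_, ?_⟩
    · intro hzz
      have := congrArg Units.val hzz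
      rw [Units.val_neg] at this
      exact z.ne_zero (self_eq_neg.mp this)
    · simp only [ht, map_mul, lev_C, lev_T, hm, hz']
    · simp only [ht, map_mul, lev_C, lev_T, hz']; simpa using ha
    · rw [hu0 z hz', hu0 _ hm]
  · exfalso
    obtain ⟨F, hF, hF'⟩ := lev_diff u
    have hd := (hF' z z.ne_zero).hasDerivAt
    have hp := (hasDerivAt_zpow k (z : ℂ) (Or.inl z.ne_zero)).const_mul α
    have hFz : F z = 0 := by rw [← hF]; exact hu0 z hz'
    have hL := (hd.pow 2).mul hp
    have hR := (hp.add_const a).mul (hp.add_const b)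
    have heq : ((F ^ 2) * fun y : ℂ => α * y ^ k) =ᶠ[nhds (z : ℂ)]
        ((fun y : ℂ => α * y ^ k + a) * fun y : ℂ => α * y ^ k + b) := by
      filter_upwards [isOpen_ne.mem_nhds z.ne_zero] with y hy
      have := congrArg (lev (Units.mk0 y hy)) h
      simp only [ht, map_mul, map_pow, map_add, lev_C, lev_T, hF] at this
      simpa using this
    have huniq := hL.unique (hR.congr_of_eventuallyEq heq)
    simp only [Pi.pow_apply, hFz, hz'] at huniq
    have h3 : α * ((k : ℂ) * (z : ℂ) ^ (k - 1)) * (b - a) = 0 := by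
      have h5 : (0 : ℂ) ^ (2 - 1) = 0 := by norm_num
      rw [h5] at huniq
      linear_combination -huniq
    have hzk : (z : ℂ) ^ (k - 1) ≠ 0 := zpow_ne_zero _ z.ne_zero
    have hkc : (k : ℂ) ≠ 0 := by exact_mod_cast hk
    exact (mul_ne_zero (mul_ne_zero hα (mul_ne_zero hkc hzk)) (sub_ne_zero.mpr (Ne.symm hab'))) h3

section
variable (𝔤 : Type) [LieRing 𝔤] [LieAlgebra ℂ 𝔤]

/-- `y ↦ y ⊗ (Aₙ Aₘ)` as a linear map. -/
noncomputable def prodMap (e₁ e₂ : ℂ) (n m : ℤ) : 𝔤 →ₗ[ℂ] (ℤ →₀ 𝔤) :=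
  if Odd n ∧ Odd m then
    Finsupp.lsingle (n + m) + (3 * e₁) • Finsupp.lsingle (n + m - 2)
      + ((e₁ - e₂) * (2 * e₁ + e₂)) • Finsupp.lsingle (n + m - 4)
  else Finsupp.lsingle (n + m)

/-- multiplication by `Aₙ`. -/
noncomputable def mulA (e₁ e₂ : ℂ) (n : ℤ) : (ℤ →₀ 𝔤) →ₗ[ℂ] (ℤ →₀ 𝔤) :=
  Finsupp.lsum ℂ fun m => prodMap 𝔤 e₁ e₂ n m

lemma mulA_even (e₁ e₂ : ℂ) (n m : ℤ) (h : Even n ∨ Even m) (x : 𝔤) :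
    mulA 𝔤 e₁ e₂ n (Finsupp.single m x) = Finsupp.single (n + m) x := by
  have : ¬ (Odd n ∧ Odd m) := by
    rw [← Int.not_even_iff_odd, ← Int.not_even_iff_odd]; tauto
  simp [mulA, prodMap, this]

lemma mulA_odd (e₁ e₂ : ℂ) (n m : ℤ) (hn : Odd n) (hm : Odd m) (x : 𝔤) :
    mulA 𝔤 e₁ e₂ n (Finsupp.single m x) = Finsupp.single (n + m) x
      + (3 * e₁) • Finsupp.single (n + m - 2) x
      + ((e₁ - e₂) * (2 * e₁ + e₂)) • Finsupp.single (n + m - 4) x := by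
  simp [mulA, prodMap, hn, hm]

lemma mulA_assoc (e₁ e₂ : ℂ) (n : ℤ) (j m : ℤ) (y : 𝔤) :
    mulA 𝔤 e₁ e₂ n (mulA 𝔤 e₁ e₂ j (Finsupp.single m y)) =
    mulA 𝔤 e₁ e₂ j (mulA 𝔤 e₁ e₂ n (Finsupp.single m y)) := by
  have hE : ∀ n : ℤ, Even n → ∀ j m : ℤ, 
    mulA 𝔤 e₁ e₂ n (mulA 𝔤 e₁ e₂ j (Finsupp.single m y)) =
    mulA 𝔤 e₁ e₂ j (mulA 𝔤 e₁ e₂ n (Finsupp.single m y)) := by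
    intro n hn j m
    rw [mulA_even _ _ _ n m (Or.inl hn)]
    rcases Int.even_or_odd j with hj | hj
    · rw [mulA_even _ _ _ _ _ (Or.inl hj), mulA_even _ _ _ _ _ (Or.inl hj),
        mulA_even _ _ _ _ _ (Or.inl hn)]
      congr 1; ring
    rcases Int.even_or_odd m with hm | hm
    · rw [mulA_even _ _ _ _ _ (Or.inr hm), mulA_even _ _ _ _ _ (Or.inl hn),
        mulA_even _ _ _ _ _ (Or.inr (hn.add hm))]
      congr 1; ring
    · rw [mulA_odd _ _ _ _ _ hj hm, mulA_odd _ _ _ _ _ hj (hn.add_odd hm)]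
      simp only [map_add, map_smul, mulA_even _ _ _ _ _ (Or.inl hn)]
      congr 2
      · congr 1; ring
      · congr 2; ring
      · congr 1; ring
  rcases Int.even_or_odd n with hn' | hn'
  · exact hE n hn' j m
  rcases Int.even_or_odd j with hj | hj
  · exact (hE j hj n m).symm
  have hnj : ∀ i, n + (j + i) = j + (n + i) := fun i => by ring
  rcases Int.even_or_odd m with hm | hm
  · rw [mulA_even _ _ _ _ _ (Or.inr hm), mulA_even _ _ _ _ _ (Or.inr hm),
      mulA_odd _ _ _ _ _ hn' (hj.add_even hm), mulA_odd _ _ _ _ _ hj (hn'.add_even hm), hnj]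
  · rw [mulA_odd _ _ _ _ _ hj hm, mulA_odd _ _ _ _ _ hn' hm]
    have h1 := hj.add_odd hm
    have h2 := hn'.add_odd hm
    simp only [map_add, map_smul]
    rw [mulA_even _ _ _ _ _ (Or.inr h1), mulA_even _ _ _ _ _ (Or.inr h2),
      mulA_even _ _ _ _ _ (Or.inr (h1.sub (by decide))), 
      mulA_even _ _ _ _ _ (Or.inr (h2.sub (by decide))),
      mulA_even _ _ _ _ _ (Or.inr (h1.sub (by decide))), 
      mulA_even _ _ _ _ _ (Or.inr (h2.sub (by decide)))]
    simp only [add_sub_assoc, hnj]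
 
end

section
variable (𝔤 : Type) [LieRing 𝔤] [LieAlgebra ℂ 𝔤]

/-- apply `ad x` coefficientwise -/
noncomputable def adF (x : 𝔤) : (ℤ →₀ 𝔤) →ₗ[ℂ] (ℤ →₀ 𝔤) :=
  Finsupp.mapRange.linearMap (LieAlgebra.ad ℂ 𝔤 x)

lemma adF_single (x : 𝔤) (m : ℤ) (y : 𝔤) :
    adF 𝔤 x (Finsupp.single m y) = Finsupp.single m ⁅x, y⁆ := by
  simp [adF]

lemma adF_mulA (e₁ e₂ : ℂ) (n : ℤ) (x : 𝔤) (g : ℤ →₀ 𝔤) :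
    mulA 𝔤 e₁ e₂ n (adF 𝔤 x g) = adF 𝔤 x (mulA 𝔤 e₁ e₂ n g) := by
  induction g using Finsupp.induction_linear with
  | zero => simp
  | add f g hf hg => simp [hf, hg]
  | single m y =>
    rw [adF_single]
    by_cases h : Odd n ∧ Odd m
    · rw [mulA_odd _ _ _ _ _ h.1 h.2, mulA_odd _ _ _ _ _ h.1 h.2]
      simp only [map_add, map_smul, adF_single]
    · have h' : Even n ∨ Even m := by
        rw [← Int.not_even_iff_odd, ← Int.not_even_iff_odd] at h; tauto
      rw [mulA_even _ _ _ _ _ h', mulA_even _ _ _ _ _ h', adF_single]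

lemma Gbr_eq (e₁ e₂ : ℂ) (f g : ℤ →₀ 𝔤) :
    Gbr 𝔤 e₁ e₂ f g = f.sum fun n x => mulA 𝔤 e₁ e₂ n (adF 𝔤 x g) := by
  unfold Gbr
  congr 1
  funext n x
  conv_rhs => rw [← Finsupp.sum_single g]
  simp only [Finsupp.sum, map_sum, adF_single]
  refine Finset.sum_congr rfl fun m _ => ?_
  split_ifs with h
  · rw [mulA_odd _ _ _ _ _ h.1 h.2]
  · rw [mulA_even]
    rw [← Int.not_even_iff_odd, ← Int.not_even_iff_odd] at h; tauto

lemma mulA_comm (e₁ e₂ : ℂ) (n j : ℤ) (g : ℤ →₀ 𝔤) :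
    mulA 𝔤 e₁ e₂ n (mulA 𝔤 e₁ e₂ j g) = mulA 𝔤 e₁ e₂ j (mulA 𝔤 e₁ e₂ n g) := by
  induction g using Finsupp.induction_linear with
  | zero => simp
  | add f g hf hg => simp [hf, hg]
  | single m y => exact mulA_assoc 𝔤 e₁ e₂ n j m y

lemma mulA_Gbr (e₁ e₂ : ℂ) (n : ℤ) (f g : ℤ →₀ 𝔤) :
    mulA 𝔤 e₁ e₂ n (Gbr 𝔤 e₁ e₂ f g) = Gbr 𝔤 e₁ e₂ f (mulA 𝔤 e₁ e₂ n g) := by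
  rw [Gbr_eq, Gbr_eq]
  simp only [Finsupp.sum, map_sum]
  refine Finset.sum_congr rfl fun m _ => ?_
  rw [mulA_comm, adF_mulA]

lemma mulA_rel (e₁ e₂ : ℂ) (f : ℤ →₀ 𝔤) :
    mulA 𝔤 e₁ e₂ 1 (mulA 𝔤 e₁ e₂ 1 (mulA 𝔤 e₁ e₂ 2 f)) =
      mulA 𝔤 e₁ e₂ 2 (mulA 𝔤 e₁ e₂ 2 f) + (3 * e₁) • mulA 𝔤 e₁ e₂ 2 f
        + ((e₁ - e₂) * (2 * e₁ + e₂)) • f := by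
  have h2 : Even (2 : ℤ) := by decide
  have h1 : Odd (1 : ℤ) := by decide
  induction f using Finsupp.induction_linear with
  | zero => simp
  | add f g hf hg => simp only [map_add, hf, hg, smul_add]; abel
  | single m y =>
    simp only [mulA_even _ _ _ _ _ (Or.inl h2)]
    rcases Int.even_or_odd m with hm | hm
    · rw [mulA_even _ _ _ _ _ (Or.inr (h2.add hm)),
        mulA_odd _ _ _ _ _ h1 (h1.add_even (h2.add hm))]
      congr 2
      · congr 1; ring
      · congr 2; ring
      · congr 1; ring
    · rw [mulA_odd _ _ _ _ _ h1 (h2.add_odd hm)]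
      have h3 := h1.add_odd (h2.add_odd hm)
      simp only [map_add, map_smul]
      rw [mulA_even _ _ _ _ _ (Or.inr h3), mulA_even _ _ _ _ _ (Or.inr (h3.sub (by decide))),
        mulA_even _ _ _ _ _ (Or.inr (h3.sub (by decide)))]
      congr 2
      · congr 1; ring
      · congr 2; ring
      · congr 1; ring

lemma mulA_inv (e₁ e₂ : ℂ) (f : ℤ →₀ 𝔤) :
    mulA 𝔤 e₁ e₂ 2 (mulA 𝔤 e₁ e₂ (-2) f) = f := by
  have h2 : Even (2 : ℤ) := by decide
  have h2' : Even (-2 : ℤ) := by decide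
  induction f using Finsupp.induction_linear with
  | zero => simp
  | add f g hf hg => simp only [map_add, hf, hg]
  | single m y =>
    rw [mulA_even _ _ _ _ _ (Or.inl h2'), mulA_even _ _ _ _ _ (Or.inl h2)]
    congr 1; ring

end

/-- evaluation `B ⊗ 𝔤 → 𝔤` at a point. -/
noncomputable def tev (𝔤 : Type) [LieRing 𝔤] [LieAlgebra ℂ 𝔤] (z : ℂˣ) :
    (LaurentPolynomial ℂ ⊗[ℂ] 𝔤) →ₗ[ℂ] 𝔤 :=
  TensorProduct.lift
    { toFun := fun p => lev z p • LinearMap.id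
      map_add' := fun p q => by rw [map_add, add_smul]
      map_smul' := fun c p => by
        rw [LaurentPolynomial.smul_eq_C_mul, map_mul, lev_C, mul_smul]; rfl }

lemma tev_tmul (𝔤 : Type) [LieRing 𝔤] [LieAlgebra ℂ 𝔤] (z : ℂˣ) (p : LaurentPolynomial ℂ)
    (x : 𝔤) : tev 𝔤 z (p ⊗ₜ x) = lev z p • x := rfl

lemma tev_smul (𝔤 : Type) [LieRing 𝔤] [LieAlgebra ℂ 𝔤] (z : ℂˣ) (p : LaurentPolynomial ℂ)
    (w : LaurentPolynomial ℂ ⊗[ℂ] 𝔤) : tev 𝔤 z (p • w) = lev z p • tev 𝔤 z w := by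
  induction w using TensorProduct.induction_on with
  | zero => simp
  | add u v hu hv => simp [hu, hv]
  | tmul q y => rw [TensorProduct.smul_tmul', tev_tmul, tev_tmul, smul_eq_mul, map_mul, mul_smul]

open LaurentPolynomial in
lemma tev_surj (𝔤 : Type) [LieRing 𝔤] [LieAlgebra ℂ 𝔤] (z z' : ℂˣ) (h : z ≠ z') :
    Function.Surjective ((tev 𝔤 z).prod (tev 𝔤 z')) := by
  have h1 : (z : ℂ) - z' ≠ 0 := sub_ne_zero.mpr (fun hh => h (Units.ext hh))
  rintro ⟨x, y⟩
  refine ⟨((T 1 - C (z' : ℂ)) ⊗ₜ (((z : ℂ) - z')⁻¹ • x)) +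
    ((C (z : ℂ) - T 1) ⊗ₜ (((z : ℂ) - z')⁻¹ • y)), ?_⟩
  change (tev 𝔤 z _, tev 𝔤 z' _) = _
  simp only [map_add, tev_tmul, map_sub, lev_C, lev_T, zpow_one,
    smul_smul, sub_self, zero_smul, zero_mul, mul_inv_cancel₀ h1, one_smul, add_zero, zero_add]

lemma transport {𝔤 : Type} [LieRing 𝔤] [LieAlgebra ℂ 𝔤]
    [FiniteDimensional ℂ 𝔤] [LieAlgebra.IsSimple ℂ 𝔤]
    (e₁ e₂ : ℂ) (φ : (ℤ →₀ 𝔤) ≃ₗ[ℂ] (LaurentPolynomial ℂ ⊗[ℂ] 𝔤))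
    (hφ : ∀ f g : ℤ →₀ 𝔤, φ (Gbr 𝔤 e₁ e₂ f g) = ⁅φ f, φ g⁆) (n : ℤ) :
    ∃ c : LaurentPolynomial ℂ, ∀ f, φ (mulA 𝔤 e₁ e₂ n f) = c • φ f := by
  obtain ⟨c, hc⟩ := centroid_mul
    (φ.toLinearMap ∘ₗ mulA 𝔤 e₁ e₂ n ∘ₗ φ.symm.toLinearMap) (by
      intro x y
      obtain ⟨f, rfl⟩ := φ.surjective x
      obtain ⟨g, rfl⟩ := φ.surjective y
      rw [← hφ]
      simp only [LinearMap.comp_apply, LinearEquiv.coe_coe, LinearEquiv.symm_apply_apply]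
      rw [mulA_Gbr, hφ])
  refine ⟨c, fun f => ?_⟩
  have := hc (φ f)
  simpa using this

/-- Let `𝔤` be a finite-dimensional simple complex Lie algebra
and `s ∈ ℂ`.  For every `e₁ ≠ 0` the Lie algebra `Ḡ^(e₁, s·e₁)` is not
isomorphic (as a complex Lie algebra) to the classical current algebra
`𝔤 ⊗ ℂ[z,z⁻¹]` (realized as the base change `ℂ[z,z⁻¹] ⊗[ℂ] 𝔤`); hence the
family over the line `D_s` is locally non-trivial despite the formal
rigidity of `𝔤 ⊗ ℂ[z,z⁻¹]`. -/
theorem G_ne_zero_not_iso_current (𝔤 : Type) [LieRing 𝔤] [LieAlgebra ℂ 𝔤]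
    [FiniteDimensional ℂ 𝔤] [LieAlgebra.IsSimple ℂ 𝔤]
    (s : ℂ) (e₁ : ℂ) (he : e₁ ≠ 0) :
    ¬ ∃ φ : (ℤ →₀ 𝔤) ≃ₗ[ℂ] (LaurentPolynomial ℂ ⊗[ℂ] 𝔤),
        ∀ f g : ℤ →₀ 𝔤, φ (Gbr 𝔤 e₁ (s * e₁) f g) = ⁅φ f, φ g⁆ := by
  rintro ⟨φ, hφ⟩
  have : Nontrivial 𝔤 := LieAlgebra.IsSimple.nontrivial ℂ 𝔤
  generalize s * e₁ = e₂ at hφ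
  obtain ⟨t, ht⟩ := transport e₁ e₂ φ hφ 2
  obtain ⟨t', ht'⟩ := transport e₁ e₂ φ hφ (-2)
  obtain ⟨u, hu⟩ := transport e₁ e₂ φ hφ 1
  have htt' : t * t' = 1 := by
    apply smul_faithful (𝔤 := 𝔤)
    intro w
    obtain ⟨f, rfl⟩ := φ.surjective w
    rw [mul_smul, ← ht', ← ht, mulA_inv, one_smul]
  obtain ⟨α, k, hα, htk⟩ := laurent_unit t t' htt'
  have h2 : Even (2 : ℤ) := by decide
  have hCs : ∀ (c : ℂ) (w : LaurentPolynomial ℂ ⊗[ℂ] 𝔤),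
      c • w = (LaurentPolynomial.C c) • w := by
    intro c w
    rw [LaurentPolynomial.C_eq_algebraMap, algebraMap_smul]
  have hk : k ≠ 0 := by
    rintro rfl
    obtain ⟨x0, hx0⟩ := exists_ne (0 : 𝔤)
    have h := ht (Finsupp.single 0 x0)
    rw [htk, LaurentPolynomial.T_zero, mul_one, ← hCs, ← map_smul] at h
    have h' := φ.injective h
    rw [mulA_even _ _ _ _ _ (Or.inl h2)] at h'
    have := congrArg (fun f : ℤ →₀ 𝔤 => f 2) h'
    simp at this
    exact hx0 this
  have hrel : u ^ 2 * t = (t + LaurentPolynomial.C (e₁ - e₂)) *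
      (t + LaurentPolynomial.C (2 * e₁ + e₂)) := by
    apply smul_faithful (𝔤 := 𝔤)
    intro w
    obtain ⟨f, rfl⟩ := φ.surjective w
    have h := congrArg φ (mulA_rel 𝔤 e₁ e₂ f)
    simp only [map_add, map_smul, hu, ht] at h
    rw [hCs, hCs, ← mul_smul, ← mul_smul, ← mul_smul, ← mul_smul, ← add_smul, ← add_smul] at h
    convert h using 2
    · ring
    · have e : (3 * e₁ : ℂ) = (e₁ - e₂) + (2 * e₁ + e₂) := by ring
      rw [e, LaurentPolynomial.C.map_add (e₁ - e₂) (2 * e₁ + e₂),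
        LaurentPolynomial.C.map_mul (e₁ - e₂) (2 * e₁ + e₂)]
      generalize LaurentPolynomial.C (e₁ - e₂) = p
      generalize LaurentPolynomial.C (2 * e₁ + e₂) = q
      ring
  obtain ⟨z, z', hzz, htz, ht0, huz⟩ := two_points t u α hα k hk htk (e₁ - e₂) (2 * e₁ + e₂)
    (by
      have : e₁ - e₂ + (2 * e₁ + e₂) = 3 * e₁ := by ring
      rw [this]
      exact mul_ne_zero (by norm_num) he) hrel
  let E : (ℤ →₀ 𝔤) →ₗ[ℂ] 𝔤 × 𝔤 := ((tev 𝔤 z).prod (tev 𝔤 z')) ∘ₗ φ.toLinearMap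
  have hEt : ∀ f, E (mulA 𝔤 e₁ e₂ 2 f) = lev z t • E f := by
    intro f
    change (tev 𝔤 z (φ _), tev 𝔤 z' (φ _)) = lev z t • (tev 𝔤 z (φ f), tev 𝔤 z' (φ f))
    rw [ht, tev_smul, tev_smul, ← htz, Prod.smul_mk]
  have hEu : ∀ f, E (mulA 𝔤 e₁ e₂ 1 f) = lev z u • E f := by
    intro f
    change (tev 𝔤 z (φ _), tev 𝔤 z' (φ _)) = lev z u • (tev 𝔤 z (φ f), tev 𝔤 z' (φ f))
    rw [hu, tev_smul, tev_smul, ← huz, Prod.smul_mk]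
  let Φ : 𝔤 →ₗ[ℂ] 𝔤 × 𝔤 := E ∘ₗ Finsupp.lsingle 0
  have hstep : ∀ (n : ℤ) (x : 𝔤),
      E (Finsupp.single (n + 2) x) = lev z t • E (Finsupp.single n x) := by
    intro n x
    rw [← hEt, mulA_even _ _ _ _ _ (Or.inl h2), add_comm]
  have heven : ∀ (j : ℤ) (x : 𝔤), E (Finsupp.single (2 * j) x) ∈ LinearMap.range Φ := by
    intro j x
    induction j using Int.induction_on with
    | zero => exact ⟨x, by simp [Φ]⟩
    | succ i hi =>
      rw [mul_add, mul_one, hstep]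
      exact Submodule.smul_mem _ _ hi
    | pred i hi =>
      have h := hstep (2 * (-(i : ℤ) - 1)) x
      have e : 2 * (-(i : ℤ) - 1) + 2 = 2 * (-(i : ℤ)) := by ring
      rw [e] at h
      rw [h] at hi
      exact (Submodule.smul_mem_iff _ ht0).mp hi
  have hall : ∀ f, E f ∈ LinearMap.range Φ := by
    intro f
    induction f using Finsupp.induction_linear with
    | zero => simp
    | add f g hf hg => rw [map_add]; exact Submodule.add_mem _ hf hg
    | single n x =>
      rcases Int.even_or_odd' n with ⟨j, rfl | rfl⟩
      · exact heven j x
      · have h := hEu (Finsupp.single (2 * j) x)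
        rw [mulA_even _ _ _ _ _ (Or.inr (even_two_mul j)), add_comm] at h
        rw [h]
        exact Submodule.smul_mem _ _ (heven j x)
  have hsurj : Function.Surjective Φ := by
    intro y
    obtain ⟨w, hw⟩ := tev_surj 𝔤 z z' hzz y
    obtain ⟨f, rfl⟩ := φ.surjective w
    have := hall f
    have hEf : E f = y := hw
    rwa [hEf] at this
  have hdim := LinearMap.finrank_le_finrank_of_surjective hsurj
  rw [Module.finrank_prod] at hdim
  have : 0 < Module.finrank ℂ 𝔤 := Module.finrank_pos
  omega
end
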